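/- arXiv:2401.01968 — 5 statements merged into one kernel-verified Lean document; each statement's English description precedes it below -/
import Mathlib

section
/- Let X be a measurable space, n a natural number, and A : Fin n → Set X a family of measurable sets. For each i, let μ i be a measure on X supported on A i (i.e., (μ i).restrict (A i) = μ i). Assume that for all i, j, (μ i).restrict (A i ∩ A j) = (μ j).restrict (A i ∩ A j). Then there exists a unique measure μ on X supported on ⋃ i, A i such that μ.restrict (A i) = μ i for every i. -/
open MeasureTheory

/-- Theorem 3.1 (measure_sheaf): compatible measures on the members of a finite
cover glue to a unique measure on the union. -/
theorem measure_sheaf {X : Type*} [MeasurableSpace X]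
    (n : ℕ) (A : Fin n → Set X) (hA : ∀ i, MeasurableSet (A i))
    (μ : Fin n → Measure X) (hsupp : ∀ i, (μ i).restrict (A i) = μ i)
    (hcompat : ∀ i j, (μ i).restrict (A i ∩ A j) = (μ j).restrict (A i ∩ A j)) :
    ∃! ν : Measure X, ν.restrict (⋃ i, A i) = ν ∧ ∀ i, ν.restrict (A i) = μ i := by
  have hD : ∀ i, MeasurableSet (disjointed A i) := fun i => by
    rw [disjointed_eq_inter_compl]
    exact (hA i).inter (MeasurableSet.iInter fun j => MeasurableSet.iInter fun _ => (hA j).compl)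
  have hsub : ∀ i, disjointed A i ⊆ A i := fun i => disjointed_subset A i
  have hglue : ∀ j,
      (Measure.sum fun i => (μ i).restrict (disjointed A i)).restrict (A j) = μ j := by
    intro j
    have h : ∀ i, ((μ i).restrict (disjointed A i)).restrict (A j) =
        ((μ j).restrict (disjointed A i)).restrict (A j) := by
      intro i
      rw [Measure.restrict_restrict (hA j), Measure.restrict_restrict (hA j)]
      exact Measure.restrict_congr_mono
        (show A j ∩ disjointed A i ⊆ A i ∩ A j from fun x hx => ⟨hsub i hx.2, hx.1⟩)
        (hcompat i j)
    rw [Measure.restrict_sum _ (hA j)]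
    simp_rw [h]
    rw [← Measure.restrict_sum _ (hA j),
      ← Measure.restrict_iUnion (disjoint_disjointed A) hD, iUnion_disjointed,
      Measure.restrict_restrict_of_subset (Set.subset_iUnion A j), hsupp j]
  have hunion : (Measure.sum fun i => (μ i).restrict (disjointed A i)).restrict (⋃ i, A i) =
      Measure.sum fun i => (μ i).restrict (disjointed A i) := by
    rw [Measure.restrict_sum _ (MeasurableSet.iUnion hA)]
    congr 1
    funext i
    rw [Measure.restrict_restrict (MeasurableSet.iUnion hA),
      Set.inter_eq_right.2 ((hsub i).trans (Set.subset_iUnion A i))]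
  refine ⟨_, ⟨hunion, hglue⟩, ?_⟩
  rintro ν ⟨hν, hνA⟩
  rw [← hν, ← hunion]
  exact Measure.restrict_iUnion_congr.2 fun i => (hνA i).trans (hglue i).symm
end

section
/- Let X be a measurable space, n a natural number, and A : Fin n → Set X a family of measurable sets. For each i, let μ i be a measure on X supported on A i (i.e., (μ i).restrict (A i) = μ i), and assume that for all i, j, (μ i).restrict (A i ∩ A j) = (μ j).restrict (A i ∩ A j). Define μ := Σ_{i} (μ i).restrict (A i \ ⋃_{j < i} A j), where the sets A i \ ⋃_{j < i} A j disjointify the cover. Then μ.restrict (A k) = μ k for every k. -/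
open MeasureTheory

/-- The explicit construction in the proof of Theorem 3.1: the glued measure is
`μ(B) = Σ_i μ_i(B ∩ A_i \ ⋃_{j<i} A_j)`. -/
theorem measure_sheaf_construction {X : Type*} [MeasurableSpace X]
    (n : ℕ) (A : Fin n → Set X) (hA : ∀ i, MeasurableSet (A i))
    (μ : Fin n → Measure X) (hsupp : ∀ i, (μ i).restrict (A i) = μ i)
    (hcompat : ∀ i j, (μ i).restrict (A i ∩ A j) = (μ j).restrict (A i ∩ A j)) :
    ∀ k, (∑ i, (μ i).restrict (A i \ ⋃ (j : Fin n) (_ : j < i), A j)).restrict (A k)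
      = μ k := by
  intro k
  have hD : ∀ i, A i \ ⋃ (j : Fin n) (_ : j < i), A j = disjointed A i := fun i => by
    simp [disjointed_apply, Finset.sup_eq_iSup]
  simp only [hD]
  have hDm : ∀ i, MeasurableSet (disjointed A i) := fun i => by
    rw [← hD]
    exact (hA i).diff (.iUnion fun j => .iUnion fun _ => hA j)
  have hrestrict : ∀ i, ((μ i).restrict (disjointed A i)).restrict (A k)
      = (μ k).restrict (disjointed A i) := fun i => by
    have hsub : disjointed A i ∩ A k ⊆ A i ∩ A k :=
      Set.inter_subset_inter_left _ (disjointed_le A i)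
    rw [Measure.restrict_restrict (hA k), Set.inter_comm,
      Measure.restrict_congr_mono hsub (hcompat i k), ← Measure.restrict_restrict (hDm i), hsupp]
  rw [← Measure.sum_fintype, Measure.restrict_sum _ (hA k)]
  simp only [hrestrict]
  rw [← Measure.restrict_iUnion (disjoint_disjointed A) hDm,
    show ⋃ i, disjointed A i = ⋃ i, A i from iSup_disjointed A]
  conv_lhs => rw [← hsupp k]
  rw [Measure.restrict_restrict' (hA k), Set.inter_eq_right.2 (Set.subset_iUnion A k), hsupp]
end

section
/- Let X be a measurable space, n a natural number, and A : Fin n → Set X a family of measurable sets. Let E be a measurable set with E ⊆ A i for every i. Suppose P and P' are probability measures on X with P(⋃ i, A i) = 1, P'(⋃ i, A i) = 1, P(E) > 0, P'(E) > 0, and cond P (A i) = cond P' (A i) for every i. Then P = P'. -/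
open MeasureTheory ProbabilityTheory

/-- Finite measures with the same conditional measure on `A` have restrictions to `A` proportional
to their values on any subset `E` of `A`. -/
theorem smul_restrict_eq_of_cond_eq {X : Type*} [MeasurableSpace X] {μ ν : Measure X}
    [IsFiniteMeasure μ] [IsFiniteMeasure ν] {A E : Set X} (hA : MeasurableSet A) (hEA : E ⊆ A)
    (h : μ[|A] = ν[|A]) :
    ν E • μ.restrict A = μ E • ν.restrict A := by
  have hμE : μ[E|A] * μ A = μ E := by
    rw [cond_mul_eq_inter hA, Set.inter_eq_right.mpr hEA]
  have hνE : ν[E|A] * ν A = ν E := by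
    rw [cond_mul_eq_inter hA, Set.inter_eq_right.mpr hEA]
  ext t ht
  simp only [Measure.smul_apply, smul_eq_mul, Measure.restrict_apply ht]
  rw [Set.inter_comm, ← cond_mul_eq_inter hA t μ, ← cond_mul_eq_inter hA t ν, ← hμE, ← hνE, h]
  ring

/-- Uniqueness part of Theorem 4.2 (prob_e): a common prior with positive
credence in `E` is determined by its conditionalizations on the members of a
finite cover. -/
theorem prob_sheaf_unique {X : Type*} [MeasurableSpace X]
    (n : ℕ) (A : Fin n → Set X) (hA : ∀ i, MeasurableSet (A i))
    (E : Set X) (hE : MeasurableSet E) (hEA : ∀ i, E ⊆ A i)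
    (P P' : Measure X) [IsProbabilityMeasure P] [IsProbabilityMeasure P']
    (hPU : P (⋃ i, A i) = 1) (hP'U : P' (⋃ i, A i) = 1)
    (hPE : 0 < P E) (hP'E : 0 < P' E)
    (h : ∀ i, P[|A i] = P'[|A i]) :
    P = P' := by
  have hU : MeasurableSet (⋃ i, A i) := .iUnion hA
  have hP : P.restrict (⋃ i, A i) = P :=
    Measure.restrict_eq_self_of_ae_mem ((prob_compl_eq_zero_iff hU).2 hPU)
  have hP' : P'.restrict (⋃ i, A i) = P' :=
    Measure.restrict_eq_self_of_ae_mem ((prob_compl_eq_zero_iff hU).2 hP'U)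
  have hsmul : P' E • P = P E • P' := by
    rw [← hP, ← hP', ← Measure.restrict_smul, ← Measure.restrict_smul, hP, hP',
      Measure.restrict_iUnion_congr]
    intro i
    simpa only [Measure.restrict_smul] using smul_restrict_eq_of_cond_eq (hA i) (hEA i) (h i)
  have hE_eq : P' E = P E := by
    simpa using congrArg (fun μ : Measure X => μ Set.univ) hsmul
  ext t
  have ht := congrArg (fun μ : Measure X => μ t) hsmul
  simp only [Measure.smul_apply, smul_eq_mul, hE_eq] at ht
  exact (ENNReal.mul_right_inj hPE.ne' (measure_ne_top P E)).1 ht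
end

section
/- Let X be a measurable space and A : ℕ → Set X a countable family of measurable sets. For each i, let μ i be a measure on X supported on A i (i.e., (μ i).restrict (A i) = μ i), and assume for all i, j that (μ i).restrict (A i ∩ A j) = (μ j).restrict (A i ∩ A j). Then there exists a unique measure μ on X supported on ⋃ i, A i such that μ.restrict (A i) = μ i for every i. -/
open MeasureTheory

/-- Theorem 3.1 remains valid for countable covering families: compatible
measures on the members of a countable cover glue to a unique measure on the
union. -/
theorem measure_sheaf_countable {X : Type*} [MeasurableSpace X]
    (A : ℕ → Set X) (hA : ∀ i, MeasurableSet (A i))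
    (μ : ℕ → Measure X) (hsupp : ∀ i, (μ i).restrict (A i) = μ i)
    (hcompat : ∀ i j, (μ i).restrict (A i ∩ A j) = (μ j).restrict (A i ∩ A j)) :
    ∃! ν : Measure X, ν.restrict (⋃ i, A i) = ν ∧ ∀ i, ν.restrict (A i) = μ i := by
  have restrict_union {ρ : Measure X} {S : Set X} (hS : S ⊆ ⋃ i, A i) :
      (ρ.restrict S).restrict (⋃ i, A i) = ρ.restrict S := by
    rw [Measure.restrict_restrict (.iUnion hA), Set.inter_eq_right.2 hS]
  have glue_union : (Measure.sum fun i => (μ i).restrict (disjointed A i)).restrict (⋃ i, A i) =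
      Measure.sum fun i => (μ i).restrict (disjointed A i) := by
    rw [Measure.restrict_sum _ (.iUnion hA)]
    congr 1
    funext i
    exact restrict_union ((disjointed_subset A i).trans (Set.subset_iUnion A i))
  have glue_member (j : ℕ) :
      (Measure.sum fun i => (μ i).restrict (disjointed A i)).restrict (A j) = μ j := by
    calc
      _ = Measure.sum fun i => (μ j).restrict (disjointed A i) := by
        rw [Measure.restrict_sum _ (hA j)]
        congr 1
        funext i
        conv_rhs => rw [← hsupp j, ← Measure.restrict_comm (hA j)]
        rw [Measure.restrict_restrict (hA j), Measure.restrict_restrict (hA j)]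
        refine Measure.restrict_congr_mono ?_ (hcompat i j)
        exact fun x hx => ⟨disjointed_subset A i hx.2, hx.1⟩
      _ = (μ j).restrict (⋃ i, A i) := by
        rw [← iUnion_disjointed (f := A), Measure.restrict_iUnion (disjoint_disjointed A)
          (MeasurableSet.disjointed hA)]
      _ = μ j := by
        rw [← hsupp j, restrict_union (Set.subset_iUnion A j)]
  refine ⟨_, ⟨glue_union, glue_member⟩, ?_⟩
  rintro ν ⟨hν, hνμ⟩
  rw [← hν, ← glue_union, Measure.restrict_iUnion_congr]
  exact fun i => (hνμ i).trans (glue_member i).symm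
end

section
/- Let X be a measurable space and A : ℕ → Set X a countable family of measurable sets. For each i, let μ i be a σ-finite measure on X supported on A i (i.e., (μ i).restrict (A i) = μ i), and assume for all i, j that (μ i).restrict (A i ∩ A j) = (μ j).restrict (A i ∩ A j). Then the unique measure μ supported on ⋃ i, A i with μ.restrict (A i) = μ i for all i is σ-finite when regarded as a measure on the subspace ⋃ i, A i. -/
open MeasureTheory

/-- A measure whose restriction to each member of a countable measurable family is σ-finite has
σ-finite restriction to the union. -/
theorem sigmaFinite_restrict_iUnion {X ι : Type*} [MeasurableSpace X] [Countable ι]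
    {ν : Measure X} {A : ι → Set X} (hA : ∀ i, MeasurableSet (A i))
    (h : ∀ i, SigmaFinite (ν.restrict (A i))) : SigmaFinite (ν.restrict (⋃ i, A i)) := by
  let S : ι × ℕ → Set X := fun p => A p.1 ∩ spanningSets (ν.restrict (A p.1)) p.2
  have hU : MeasurableSet (⋃ i, A i) := MeasurableSet.iUnion hA
  refine Measure.sigmaFinite_of_countable (S := insert (⋃ i, A i)ᶜ (Set.range S))
    ((Set.countable_range S).insert _) ?_ ?_
  · rintro s (rfl | ⟨⟨i, n⟩, rfl⟩)
    · rw [Measure.restrict_apply hU.compl, Set.compl_inter_self, measure_empty]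
      exact ENNReal.zero_lt_top
    · have hfin := measure_spanningSets_lt_top (ν.restrict (A i)) n
      rw [Measure.restrict_apply (measurableSet_spanningSets _ _), Set.inter_comm] at hfin
      exact (Measure.restrict_apply_le _ _).trans_lt hfin
  · refine Set.eq_univ_of_forall fun x => ?_
    by_cases hx : x ∈ ⋃ i, A i
    · obtain ⟨i, hi⟩ := Set.mem_iUnion.1 hx
      obtain ⟨n, hn⟩ := Set.mem_iUnion.1
        ((iUnion_spanningSets (ν.restrict (A i))).symm ▸ Set.mem_univ x)
      exact ⟨S (i, n), Or.inr ⟨_, rfl⟩, hi, hn⟩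
    · exact ⟨_, Or.inl rfl, hx⟩

/-- Corollary 3.2 for countable covers with "finite" replaced by "σ-finite":
the gluing of compatible σ-finite measures on a countable cover is σ-finite on
the union. -/
theorem sigma_finite_measure_sheaf_countable {X : Type*} [MeasurableSpace X]
    (A : ℕ → Set X) (hA : ∀ i, MeasurableSet (A i))
    (μ : ℕ → Measure X) (hsf : ∀ i, SigmaFinite (μ i))
    (hsupp : ∀ i, (μ i).restrict (A i) = μ i)
    (hcompat : ∀ i j, (μ i).restrict (A i ∩ A j) = (μ j).restrict (A i ∩ A j)) :
    ∀ ν : Measure X, ν.restrict (⋃ i, A i) = ν → (∀ i, ν.restrict (A i) = μ i) →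
      SigmaFinite (ν.restrict (⋃ i, A i)) := by
  intro ν _ hν
  exact sigmaFinite_restrict_iUnion hA fun i => (hν i).symm ▸ hsf i
end
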